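/- For every integer a, the odd writhe of the virtual knot K(a) equals 2a, i.e., J(K(a)) = 2a. -/

import Mathlib

/-!
Combinatorial Gauss diagrams.

A Gauss diagram is encoded as a list of chord endpoints read along the
oriented circle from a basepoint.  Each endpoint records the (natural number)
label of its chord, whether it is the terminal endpoint of the (oriented)
chord, and the sign of the chord (`true` = +1, `false` = -1).
Diagrams are considered up to rotation of the basepoint and relabeling of the
chords; these renamings are included among the "Reidemeister" generators.
-/

structure Endpoint where
  label : ℕ
  isTerminal : Bool
  sign : Bool
deriving DecidableEq

namespace Gauss

/-- The sign (±1) of the chord through an endpoint. -/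
def signValue (e : Endpoint) : ℤ := if e.sign then 1 else -1

/-- The sign assigned to an endpoint: `ε` at the terminal endpoint and `-ε`
at the initial endpoint of a chord of sign `ε`. -/
def endpointValue (e : Endpoint) : ℤ := if e.isTerminal then signValue e else -signValue e

/-- The list of chord labels of the endpoints of a word. -/
def labels (L : List Endpoint) : List ℕ := L.map Endpoint.label

/-- A word is a Gauss diagram when every chord label occurring in it occurs
exactly twice, once as an initial and once as a terminal endpoint, with the
same sign at both occurrences. -/
def IsGaussDiagram (L : List Endpoint) : Prop :=
  ∀ e ∈ L, (L.filter (fun x => x.label == e.label)).length = 2 ∧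
    ∃ e' ∈ L, e'.label = e.label ∧ e'.isTerminal = !e.isTerminal ∧ e'.sign = e.sign

/-- Rotate a word so that the first endpoint satisfying `p` comes first. -/
def rotateTo (L : List Endpoint) (p : Endpoint → Bool) : List Endpoint :=
  match L.findIdx? p with
  | some i => L.drop i ++ L.take i
  | none => L

/-- The index of the chord labeled `c`: the sum of the signs assigned to the
endpoints on the arc running from the initial endpoint of the chord to its
terminal endpoint in the direction of the circle's orientation. -/
def chordIndex (L : List Endpoint) (c : ℕ) : ℤ :=
  ((((rotateTo L (fun e => e.label == c && !e.isTerminal)).drop 1).takeWhile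
      (fun e => e.label != c)).map endpointValue).sum

/-- `Jn L n`: the sum of the signs of the chords of `L` of index `n`. -/
def Jn (L : List Endpoint) (n : ℤ) : ℤ :=
  ((L.filter (fun e => e.isTerminal && decide (chordIndex L e.label = n))).map signValue).sum

/-- The odd writhe: the sum of the signs of the chords of odd index,
i.e. `J = Σ_{n odd} J_n`. -/
def oddWrithe (L : List Endpoint) : ℤ :=
  ((L.filter (fun e => e.isTerminal && decide (chordIndex L e.label % 2 ≠ 0))).map signValue).sum

/-- Moving the basepoint of the circle. -/
def rotateStep (L L' : List Endpoint) : Prop :=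
  ∃ x xs, L = x :: xs ∧ L' = xs ++ [x]

/-- Injective relabeling of the chords. -/
def relabelStep (L L' : List Endpoint) : Prop :=
  ∃ f : ℕ → ℕ, Function.Injective f ∧
    L' = L.map (fun e => Endpoint.mk (f e.label) e.isTerminal e.sign)

/-- Reidemeister move I (removal direction): remove an isolated chord whose
two endpoints are adjacent (either orientation, either sign). -/
def reid1 (L L' : List Endpoint) : Prop :=
  ∃ (A B : List Endpoint) (c : ℕ) (t s : Bool),
    c ∉ labels (A ++ B) ∧
    L = A ++ [Endpoint.mk c t s, Endpoint.mk c (!t) s] ++ B ∧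
    L' = A ++ B

/-- Reidemeister move II (removal direction): remove two chords of opposite
signs whose initial endpoints are adjacent and whose terminal endpoints are
adjacent (in either of the two admissible orders). -/
def reid2 (L L' : List Endpoint) : Prop :=
  ∃ (A B C : List Endpoint) (c d : ℕ) (s crossed : Bool),
    c ≠ d ∧ c ∉ labels (A ++ B ++ C) ∧ d ∉ labels (A ++ B ++ C) ∧
    L = A ++ [Endpoint.mk c false s, Endpoint.mk d false (!s)] ++ B ++
        (if crossed then [Endpoint.mk c true s, Endpoint.mk d true (!s)]
         else [Endpoint.mk d true (!s), Endpoint.mk c true s]) ++ C ∧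
    L' = A ++ B ++ C

/-- Reidemeister move III (a standard variant; together with the moves I, II,
rotations and relabelings it generates all versions of the third move). -/
def reid3 (L L' : List Endpoint) : Prop :=
  ∃ (A B C D : List Endpoint) (a b c : ℕ) (s : Bool),
    a ≠ b ∧ b ≠ c ∧ a ≠ c ∧
    L = A ++ [Endpoint.mk b false s, Endpoint.mk a false s] ++ B ++
        [Endpoint.mk a true s, Endpoint.mk c false (!s)] ++ C ++
        [Endpoint.mk b true s, Endpoint.mk c true (!s)] ++ D ∧
    L' = A ++ [Endpoint.mk a false s, Endpoint.mk b false s] ++ B ++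
        [Endpoint.mk c false (!s), Endpoint.mk a true s] ++ C ++
        [Endpoint.mk c true (!s), Endpoint.mk b true s] ++ D

/-- A single Reidemeister generator (including diagram renamings). -/
def reidStep (L L' : List Endpoint) : Prop :=
  rotateStep L L' ∨ relabelStep L L' ∨ reid1 L L' ∨ reid2 L L' ∨ reid3 L L'

/-- A Ξ-move: exchange the first and third of three consecutive endpoints
belonging to three distinct chords, keeping all signs and orientations. -/
def xiStep (L L' : List Endpoint) : Prop :=
  ∃ (A B : List Endpoint) (x y z : Endpoint),
    x.label ≠ y.label ∧ y.label ≠ z.label ∧ x.label ≠ z.label ∧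
    L = A ++ [x, y, z] ++ B ∧
    L' = A ++ [z, y, x] ++ B

/-- A 2k-move (removal direction): remove `2k` chords `c 0, …, c (2k-1)`, all
of sign `s`, whose `p`-endpoints appear consecutively on one arc and whose
`q`-endpoints appear consecutively on a disjoint arc, the chord `c i` being
oriented from `p` to `q` for even `i` (the paper's odd `i`, 1-indexed) and
from `q` to `p` for odd `i`, so initial and terminal endpoints alternate. -/
def move2k (k : ℕ) (L L' : List Endpoint) : Prop :=
  ∃ (A B C : List Endpoint) (c : ℕ → ℕ) (s : Bool),
    (∀ i < 2 * k, ∀ j < 2 * k, c i = c j → i = j) ∧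
    (∀ i < 2 * k, c i ∉ labels (A ++ B ++ C)) ∧
    L = A ++ (List.range (2 * k)).map (fun i => Endpoint.mk (c i) (decide (i % 2 = 1)) s)
          ++ B ++
        (List.range (2 * k)).map (fun i => Endpoint.mk (c i) (decide (i % 2 = 0)) s)
          ++ C ∧
    L' = A ++ B ++ C

/-- A crossing change: reverse the sign and the orientation of one chord. -/
def crossingChange (L L' : List Endpoint) : Prop :=
  ∃ c : ℕ,
    L' = L.map (fun e =>
      if e.label = c then Endpoint.mk e.label (!e.isTerminal) (!e.sign) else e)

/-- Finite sequences of moves from `r`, performed in either direction. -/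
def Moves (r : List Endpoint → List Endpoint → Prop) :
    List Endpoint → List Endpoint → Prop :=
  Relation.ReflTransGen (fun L L' => r L L' ∨ r L' L)

/-- Related by Reidemeister moves: the two words represent the same virtual knot. -/
def ReidEquiv : List Endpoint → List Endpoint → Prop := Moves reidStep

/-- Related by a finite sequence of 2k-moves (and Reidemeister moves). -/
def Rel2k (k : ℕ) : List Endpoint → List Endpoint → Prop :=
  Moves (fun L L' => reidStep L L' ∨ move2k k L L')

/-- Related by a finite sequence of Ξ-moves (and Reidemeister moves). -/
def RelXi : List Endpoint → List Endpoint → Prop :=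
  Moves (fun L L' => reidStep L L' ∨ xiStep L L')

/-- Related by a finite sequence of 2k-moves and Ξ-moves (and Reidemeister moves). -/
def Rel2kXi (k : ℕ) : List Endpoint → List Endpoint → Prop :=
  Moves (fun L L' => reidStep L L' ∨ move2k k L L' ∨ xiStep L L')

/-- Related by a finite sequence of crossing changes and Ξ-moves
(and Reidemeister moves). -/
def RelCCXi : List Endpoint → List Endpoint → Prop :=
  Moves (fun L L' => reidStep L L' ∨ crossingChange L L' ∨ xiStep L L')

/-- A shell-pair of sign `s`: two chords `c`, `d` of sign `s` whose four
endpoints are consecutive, interleaved as 1st-3rd and 2nd-4th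
(with arbitrary orientations `t`, `u` of the two shells). -/
def shellPair (c d : ℕ) (t u s : Bool) : List Endpoint :=
  [Endpoint.mk c t s, Endpoint.mk d u s, Endpoint.mk c (!t) s, Endpoint.mk d (!u) s]

/-- The Gauss diagram `G(a)`: `|a|` consecutive shell-pairs of sign `+1` if
`a > 0` and of sign `-1` if `a < 0`; `G(0)` has no chords.  It represents the
virtual knot `K(a)`. -/
def Gword (a : ℤ) : List Endpoint :=
  ((List.range a.natAbs).map
    (fun j => shellPair (2 * j) (2 * j + 1) false false (decide (0 < a)))).flatten

/-- `Rel2kCount k m G G'`: `G` and `G'` are related by a finite sequence of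
Reidemeister moves and exactly `m` 2k-moves. -/
inductive Rel2kCount (k : ℕ) : ℕ → List Endpoint → List Endpoint → Prop
  | refl (L : List Endpoint) : Rel2kCount k 0 L L
  | reid {m : ℕ} {L L' L'' : List Endpoint} :
      reidStep L L' ∨ reidStep L' L →
      Rel2kCount k m L' L'' → Rel2kCount k m L L''
  | move {m : ℕ} {L L' L'' : List Endpoint} :
      move2k k L L' ∨ move2k k L' L →
      Rel2kCount k m L' L'' → Rel2kCount k (m + 1) L L''

/-- The 2k-move distance: the minimal number of 2k-moves needed to relate the
two diagrams (together with Reidemeister moves). -/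
noncomputable def dist2k (k : ℕ) (L L' : List Endpoint) : ℕ :=
  sInf {m | Rel2kCount k m L L'}

end Gauss

namespace Gauss

theorem chordIndex_split (A M B : List Endpoint) (c : ℕ) (s s' : Bool)
    (hA : ∀ x ∈ A, x.label ≠ c) (hM : ∀ x ∈ M, x.label ≠ c) :
    chordIndex (A ++ (Endpoint.mk c false s :: (M ++ (Endpoint.mk c true s' :: B)))) c
      = (M.map endpointValue).sum := by
  have hidx : (A ++ (Endpoint.mk c false s :: (M ++ (Endpoint.mk c true s' :: B)))).findIdx?
      (fun e => e.label == c && !e.isTerminal) = some A.length := by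
    rw [List.findIdx?_append]
    have : A.findIdx? (fun e => e.label == c && !e.isTerminal) = none := by
      rw [List.findIdx?_eq_none_iff]
      intro x hx
      simp [hA x hx]
    rw [this]
    simp [List.findIdx?_cons]
  unfold chordIndex rotateTo
  rw [hidx]
  simp only [List.drop_left, List.take_left, List.cons_append, List.drop_succ_cons, List.drop_zero,
    List.append_assoc]
  rw [List.takeWhile_append_of_pos (by intro x hx; simpa using hM x hx)]
  simp

/-- `n` consecutive shell-pairs starting from index `m`. -/
def shells (s : Bool) (l : List ℕ) : List Endpoint :=
  (l.map (fun j => shellPair (2 * j) (2 * j + 1) false false s)).flatten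

theorem mem_shells {s : Bool} {l : List ℕ} {x : Endpoint} (hx : x ∈ shells s l) :
    ∃ j ∈ l, x ∈ shellPair (2 * j) (2 * j + 1) false false s := by
  simpa [shells] using hx

theorem chordIndex_shells (s : Bool) (n j : ℕ) (hj : j < n) :
    chordIndex (shells s (List.range n)) (2 * j) % 2 ≠ 0 ∧
    chordIndex (shells s (List.range n)) (2 * j + 1) % 2 ≠ 0 := by
  obtain ⟨l₁, l₂, hl⟩ := List.append_of_mem (List.mem_range.2 hj)
  have hnd : (l₁ ++ j :: l₂).Nodup := hl ▸ List.nodup_range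
  have hj1 : j ∉ l₁ := by
    intro h
    rw [List.nodup_append] at hnd
    exact hnd.2.2 j h j (by simp) rfl
  have hlab : ∀ x ∈ shells s l₁, x.label ≠ 2 * j ∧ x.label ≠ 2 * j + 1 := by
    intro x hx
    obtain ⟨i, hi, hx⟩ := mem_shells hx
    have : i ≠ j := fun h => hj1 (h ▸ hi)
    simp only [shellPair, List.mem_cons, List.not_mem_nil, or_false] at hx
    rcases hx with rfl | rfl | rfl | rfl <;> simp only <;> omega
  rw [hl]
  have e : shells s (l₁ ++ j :: l₂) = shells s l₁ ++
      (Endpoint.mk (2 * j) false s :: Endpoint.mk (2 * j + 1) false s ::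
        Endpoint.mk (2 * j) true s :: Endpoint.mk (2 * j + 1) true s :: shells s l₂) := by
    simp [shells, shellPair]
  rw [e]
  constructor
  · have := chordIndex_split (shells s l₁) [Endpoint.mk (2 * j + 1) false s]
      (Endpoint.mk (2 * j + 1) true s :: shells s l₂) (2 * j) s s
      (fun x hx => (hlab x hx).1) (by simp)
    simp only [List.cons_append, List.nil_append] at this
    rw [this]
    cases s <;> simp [endpointValue, signValue]
  · have := chordIndex_split (shells s l₁ ++ [Endpoint.mk (2 * j) false s])
      [Endpoint.mk (2 * j) true s] (shells s l₂) (2 * j + 1) s s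
      (by
        intro x hx
        rcases List.mem_append.1 hx with hx | hx
        · exact (hlab x hx).2
        · simp only [List.mem_singleton] at hx
          subst hx
          simp)
      (by simp)
    simp only [List.cons_append, List.nil_append, List.append_assoc] at this
    rw [this]
    cases s <;> simp [endpointValue, signValue]

theorem sum_terminal_shells (s : Bool) (l : List ℕ) :
    (((shells s l).filter (fun e => e.isTerminal)).map signValue).sum
      = 2 * (if s then 1 else -1) * (l.length : ℤ) := by
  induction l with
  | nil => simp [shells]
  | cons j l ih =>
    have e : shells s (j :: l) = shellPair (2 * j) (2 * j + 1) false false s ++ shells s l := by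
      simp [shells]
    rw [e, List.filter_append, List.map_append, List.sum_append, ih]
    cases s <;> simp [shellPair, signValue] <;> ring

theorem oddWrithe_shells (s : Bool) (n : ℕ) :
    oddWrithe (shells s (List.range n)) = 2 * (if s then 1 else -1) * (n : ℤ) := by
  have h := sum_terminal_shells s (List.range n)
  rw [List.length_range] at h
  rw [← h]
  unfold oddWrithe
  congr 2
  apply List.filter_congr
  intro x hx
  obtain ⟨j, hj, hx⟩ := mem_shells hx
  have hc := chordIndex_shells s n j (List.mem_range.1 hj)
  simp only [shellPair, List.mem_cons, List.not_mem_nil, or_false] at hx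
  rcases hx with rfl | rfl | rfl | rfl
  · simp
  · simp
  · simpa using hc.1
  · simpa using hc.2

end Gauss

open Gauss in
/-- the odd writhe of `K(a)` equals `2a`. -/
theorem oddWrithe_Gword (a : ℤ) : oddWrithe (Gword a) = 2 * a := by
  have h := oddWrithe_shells (decide (0 < a)) a.natAbs
  change oddWrithe (Gword a) = _ at h
  rw [h]
  by_cases ha : 0 < a
  · simp only [ha, decide_true, if_true]
    omega
  · simp only [ha, decide_false, Bool.false_eq_true, if_false]
    omega
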